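/- arXiv:2306.06056 — 2 statements merged into one kernel-verified Lean document; each statement's English description precedes it below -/
import Mathlib

section
/- Let A ∈ F₂^{m_a×n} and B ∈ F₂^{m_b×n} satisfy A·Bᵀ = 0, with ranks r_a, r_b respectively. Then there exist permutation matrices P_a ∈ F₂^{m_a×m_a}, P_b ∈ F₂^{m_b×m_b}, Q ∈ F₂^{n×n}; a lower triangular matrix L_a ∈ F₂^{m_a×m_a} with unit diagonal; upper triangular matrices L_b ∈ F₂^{m_b×m_b} and R ∈ F₂^{n×n} with unit diagonal; and matrices D_a ∈ F₂^{m_a×n} with ones exactly in entries (i,i) for 0 ≤ i < r_a, and D_b ∈ F₂^{m_b×n} with ones exactly in entries (m_b−r_b+i, n−r_b+i) for 0 ≤ i < r_b, such that P_a A Q = L_a D_a R and P_b B Q = L_b D_b (R⁻¹)ᵀ. -/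
open Matrix
open scoped Classical

/-- `P` is a permutation matrix. -/
def IsPermMatrix {n : ℕ} (P : Matrix (Fin n) (Fin n) (ZMod 2)) : Prop :=
  ∃ σ : Equiv.Perm (Fin n), ∀ i j, P i j = if σ j = i then 1 else 0

/-- The matrix with ones exactly in the entries `(a + t, b + t)` for `t < r`. -/
noncomputable def diagBlock (m n a b r : ℕ) : Matrix (Fin m) (Fin n) (ZMod 2) :=
  Matrix.of fun i j => if ∃ t : ℕ, t < r ∧ (i : ℕ) = a + t ∧ (j : ℕ) = b + t then 1 else 0

theorem rank_diagBlock {m n a b r : ℕ} (hm : a + r ≤ m) (hn : b + r ≤ n) :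
    (diagBlock m n a b r).rank = r := by
  have hE : (diagBlock m n a b r).submatrix
      (fun t : Fin r => (⟨a + t, by omega⟩ : Fin m)) (fun t : Fin r => (⟨b + t, by omega⟩ : Fin n))
      = 1 := by
    ext i j
    simp only [diagBlock, submatrix_apply, of_apply, one_apply, Fin.ext_iff]
    refine if_congr ⟨?_, fun h => ⟨i, i.2, rfl, by omega⟩⟩ rfl rfl
    rintro ⟨t, -, h1, h2⟩
    omega
  have hF : diagBlock m n a b r = diagBlock m r a 0 r * diagBlock r n 0 b r := by
    ext i j
    simp only [diagBlock, mul_apply, of_apply, mul_ite, mul_one, mul_zero, ← ite_and]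
    split_ifs with h
    · obtain ⟨t, ht, h1, h2⟩ := h
      rw [Finset.sum_eq_single (⟨t, ht⟩ : Fin r), if_pos]
      · exact ⟨⟨t, ht, by simp, h2⟩, ⟨t, ht, h1, by simp⟩⟩
      · rintro k - hk
        rw [if_neg]
        rintro ⟨-, s, -, h3, h4⟩
        exact hk (Fin.ext (by simp only; omega))
      · simp
    · refine (Finset.sum_eq_zero fun k _ => if_neg ?_).symm
      rintro ⟨⟨t, ht, h1, h2⟩, ⟨s, hs, h3, h4⟩⟩
      exact h ⟨t, ht, by omega, h2⟩
  apply le_antisymm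
  · rw [hF]
    exact (rank_mul_le_left _ _).trans (by simpa using rank_le_width (diagBlock m r a 0 r))
  · have h := rank_submatrix_le (diagBlock m n a b r)
      (fun t : Fin r => (⟨a + t, by omega⟩ : Fin m)) (fun t : Fin r => (⟨b + t, by omega⟩ : Fin n))
    rw [hE, rank_one] at h
    simpa using h

/-- Upper triangular with unit diagonal. -/
def IsUpperUnitriangular {n : ℕ} (M : Matrix (Fin n) (Fin n) (ZMod 2)) : Prop :=
  (∀ i j : Fin n, (j : ℕ) < (i : ℕ) → M i j = 0) ∧ ∀ i, M i i = 1

/-- Lower triangular with unit diagonal. -/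
def IsLowerUnitriangular {n : ℕ} (M : Matrix (Fin n) (Fin n) (ZMod 2)) : Prop :=
  (∀ i j : Fin n, (i : ℕ) < (j : ℕ) → M i j = 0) ∧ ∀ i, M i i = 1

theorem isUpperUnitriangular_one {n : ℕ} :
    IsUpperUnitriangular (1 : Matrix (Fin n) (Fin n) (ZMod 2)) :=
  ⟨fun _ _ h => one_apply_ne (by rintro rfl; exact lt_irrefl _ h), fun _ => one_apply_eq _⟩

theorem isLowerUnitriangular_one {n : ℕ} :
    IsLowerUnitriangular (1 : Matrix (Fin n) (Fin n) (ZMod 2)) :=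
  ⟨fun _ _ h => one_apply_ne (by rintro rfl; exact lt_irrefl _ h), fun _ => one_apply_eq _⟩

theorem IsUpperUnitriangular.rev {n : ℕ} {M : Matrix (Fin n) (Fin n) (ZMod 2)}
    (h : IsUpperUnitriangular M) :
    IsLowerUnitriangular (M.submatrix Fin.revPerm Fin.revPerm) :=
  ⟨fun i j hij => h.1 _ _ (by simp only [Fin.revPerm_apply, Fin.val_rev]; omega), fun _ => h.2 _⟩

theorem IsLowerUnitriangular.rev {n : ℕ} {M : Matrix (Fin n) (Fin n) (ZMod 2)}
    (h : IsLowerUnitriangular M) :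
    IsUpperUnitriangular (M.submatrix Fin.revPerm Fin.revPerm) :=
  ⟨fun i j hij => h.1 _ _ (by simp only [Fin.revPerm_apply, Fin.val_rev]; omega), fun _ => h.2 _⟩

theorem diagBlock_rev {m n r : ℕ} (hm : r ≤ m) (hn : r ≤ n) :
    (diagBlock m n 0 0 r).submatrix Fin.revPerm Fin.revPerm
      = diagBlock m n (m - r) (n - r) r := by
  ext i j
  simp only [diagBlock, submatrix_apply, of_apply, Fin.revPerm_apply, Fin.val_rev]
  refine if_congr ⟨?_, ?_⟩ rfl rfl
  · rintro ⟨t, ht, h1, h2⟩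
    exact ⟨r - 1 - t, by omega, by omega, by omega⟩
  · rintro ⟨t, ht, h1, h2⟩
    exact ⟨r - 1 - t, by omega, by omega, by omega⟩

theorem diagBlock_rev' {m n r : ℕ} (hm : r ≤ m) (hn : r ≤ n) :
    (diagBlock m n (m - r) (n - r) r).submatrix Fin.revPerm Fin.revPerm
      = diagBlock m n 0 0 r := by
  rw [← diagBlock_rev hm hn]
  ext i j
  simp

/-- The block matrix `[a, u; v, M]` with scalar upper left corner. -/
def border {m n : ℕ} (a : ZMod 2) (u : Fin n → ZMod 2) (v : Fin m → ZMod 2)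
    (M : Matrix (Fin m) (Fin n) (ZMod 2)) : Matrix (Fin (m + 1)) (Fin (n + 1)) (ZMod 2) :=
  Matrix.of (Fin.cons (Fin.cons a u) fun i => Fin.cons (v i) (M i))

/-- The block matrix `[b, N]` with first column `b`. -/
def consCol {m n : ℕ} (b : Fin m → ZMod 2) (N : Matrix (Fin m) (Fin n) (ZMod 2)) :
    Matrix (Fin m) (Fin (n + 1)) (ZMod 2) :=
  Matrix.of fun i => Fin.cons (b i) (N i)

section border

variable {l m n : ℕ} (a : ZMod 2) (u : Fin n → ZMod 2) (v : Fin m → ZMod 2)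
  (M : Matrix (Fin m) (Fin n) (ZMod 2))

@[simp] theorem border_zero_zero : border a u v M 0 0 = a := rfl

@[simp] theorem border_zero_succ (j : Fin n) : border a u v M 0 j.succ = u j := rfl

@[simp] theorem border_succ_zero (i : Fin m) : border a u v M i.succ 0 = v i := rfl

@[simp] theorem border_succ_succ (i : Fin m) (j : Fin n) :
    border a u v M i.succ j.succ = M i j := rfl

@[simp] theorem consCol_zero (i : Fin m) : consCol v M i 0 = v i := rfl

@[simp] theorem consCol_succ (i : Fin m) (j : Fin n) : consCol v M i j.succ = M i j := rfl

theorem border_mul_border (b : ZMod 2) (x : Fin l → ZMod 2) (y : Fin n → ZMod 2)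
    (N : Matrix (Fin n) (Fin l) (ZMod 2)) :
    border a u v M * border b x y N =
      border (a * b + u ⬝ᵥ y) (a • x + u ᵥ* N) (b • v + M *ᵥ y) (vecMulVec v x + M * N) := by
  ext i j
  refine Fin.cases ?_ (fun i => ?_) i <;> refine Fin.cases ?_ (fun j => ?_) j <;>
    simp [mul_apply, Fin.sum_univ_succ, dotProduct, vecMul, mulVec, vecMulVec_apply, mul_comm]

theorem consCol_mul_border (b : ZMod 2) (x : Fin l → ZMod 2) (y : Fin n → ZMod 2)
    (N : Matrix (Fin n) (Fin l) (ZMod 2)) :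
    consCol v M * border b x y N = consCol (b • v + M *ᵥ y) (vecMulVec v x + M * N) := by
  ext i j
  refine Fin.cases ?_ (fun j => ?_) j <;>
    simp [mul_apply, Fin.sum_univ_succ, dotProduct, mulVec, vecMulVec_apply, mul_comm]

theorem mul_consCol (L : Matrix (Fin l) (Fin m) (ZMod 2)) :
    L * consCol v M = consCol (L *ᵥ v) (L * M) := by
  ext i j
  refine Fin.cases ?_ (fun j => ?_) j <;> simp [mul_apply, dotProduct, mulVec]

theorem border_transpose : (border a u v M)ᵀ = border a v u Mᵀ := by
  ext i j
  refine Fin.cases ?_ (fun i => ?_) i <;> refine Fin.cases ?_ (fun j => ?_) j <;> simp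

theorem border_one : border 1 0 0 (1 : Matrix (Fin n) (Fin n) (ZMod 2)) = 1 := by
  ext i j
  refine Fin.cases ?_ (fun i => ?_) i <;> refine Fin.cases ?_ (fun j => ?_) j <;>
    simp [one_apply, Fin.succ_ne_zero, (Fin.succ_ne_zero _).symm]

theorem border_diagBlock (r : ℕ) :
    border 1 0 0 (diagBlock m n 0 0 r) = diagBlock (m + 1) (n + 1) 0 0 (r + 1) := by
  ext i j
  refine Fin.cases ?_ (fun i => ?_) i <;> refine Fin.cases ?_ (fun j => ?_) j
  · simp [diagBlock]
  · simp [diagBlock]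
  · simp [diagBlock]
  · simp only [border_succ_succ, diagBlock, of_apply, Fin.val_succ]
    refine if_congr ⟨?_, ?_⟩ rfl rfl
    · rintro ⟨t, ht, h1, h2⟩
      exact ⟨t + 1, by omega, by omega, by omega⟩
    · rintro ⟨t, ht, h1, h2⟩
      exact ⟨t - 1, by omega, by omega, by omega⟩

theorem consCol_diagBlock {r : ℕ} (hn : r ≤ n) (c : ℕ) :
    consCol 0 (diagBlock m n c (n - r) r) = diagBlock m (n + 1) c (n + 1 - r) r := by
  ext i j
  refine Fin.cases ?_ (fun j => ?_) j
  · simp only [consCol_zero, diagBlock, of_apply, Fin.val_zero, Pi.zero_apply]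
    refine (if_neg ?_).symm
    rintro ⟨t, ht, h1, h2⟩
    omega
  · simp only [consCol_succ, diagBlock, of_apply, Fin.val_succ]
    refine if_congr ⟨?_, ?_⟩ rfl rfl
    · rintro ⟨t, ht, h1, h2⟩
      exact ⟨t, by omega, by omega, by omega⟩
    · rintro ⟨t, ht, h1, h2⟩
      exact ⟨t, by omega, by omega, by omega⟩

variable {u} in
theorem IsUpperUnitriangular.border {R : Matrix (Fin n) (Fin n) (ZMod 2)}
    (h : IsUpperUnitriangular R) : IsUpperUnitriangular (border 1 u 0 R) := by
  refine ⟨fun i j => ?_, fun i => ?_⟩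
  · refine Fin.cases ?_ (fun i => ?_) i <;> refine Fin.cases ?_ (fun j => ?_) j
    · simp
    · simp
    · simp
    · simpa using h.1 i j
  · refine Fin.cases ?_ (fun i => ?_) i
    · simp
    · simpa using h.2 i

variable {u} in
theorem IsLowerUnitriangular.border {R : Matrix (Fin n) (Fin n) (ZMod 2)}
    (h : IsLowerUnitriangular R) : IsLowerUnitriangular (border 1 0 u R) := by
  refine ⟨fun i j => ?_, fun i => ?_⟩
  · refine Fin.cases ?_ (fun i => ?_) i <;> refine Fin.cases ?_ (fun j => ?_) j
    · simp
    · simp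
    · simp
    · simpa using h.1 i j
  · refine Fin.cases ?_ (fun i => ?_) i
    · simp
    · simpa using h.2 i

end border

/-- The permutation of `Fin (n + 1)` fixing `0` and acting as `σ` on successors. -/
def succPerm {n : ℕ} (σ : Equiv.Perm (Fin n)) : Equiv.Perm (Fin (n + 1)) :=
  Equiv.Perm.decomposeFin.symm (0, σ)

@[simp] theorem succPerm_zero {n : ℕ} (σ : Equiv.Perm (Fin n)) : succPerm σ 0 = 0 := by
  simp [succPerm]

@[simp] theorem succPerm_succ {n : ℕ} (σ : Equiv.Perm (Fin n)) (i : Fin n) :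
    succPerm σ i.succ = (σ i).succ := by
  simp [succPerm]

theorem border_submatrix {m n : ℕ} (a : ZMod 2) (u : Fin n → ZMod 2) (v : Fin m → ZMod 2)
    (M : Matrix (Fin m) (Fin n) (ZMod 2)) (σ : Equiv.Perm (Fin m)) (τ : Equiv.Perm (Fin n)) :
    (border a u v M).submatrix (succPerm σ) (succPerm τ)
      = border a (u ∘ τ) (v ∘ σ) (M.submatrix σ τ) := by
  ext i j
  refine Fin.cases ?_ (fun i => ?_) i <;> refine Fin.cases ?_ (fun j => ?_) j <;> simp

theorem consCol_submatrix {m n : ℕ} (b : Fin m → ZMod 2)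
    (N : Matrix (Fin m) (Fin n) (ZMod 2)) (ρ : Equiv.Perm (Fin m)) (τ : Equiv.Perm (Fin n)) :
    (consCol b N).submatrix ρ (succPerm τ) = consCol (b ∘ ρ) (N.submatrix ρ τ) := by
  ext i j
  refine Fin.cases ?_ (fun j => ?_) j <;> simp

/-- A joint decomposition of `A` and `B`, with permutations in place of permutation matrices and
`S` in place of `(R⁻¹)ᵀ`. -/
def HasJointDecomposition {ma mb n : ℕ}
    (A : Matrix (Fin ma) (Fin n) (ZMod 2)) (B : Matrix (Fin mb) (Fin n) (ZMod 2)) : Prop :=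
  ∃ (σ : Equiv.Perm (Fin ma)) (ρ : Equiv.Perm (Fin mb)) (τ : Equiv.Perm (Fin n))
    (La : Matrix (Fin ma) (Fin ma) (ZMod 2)) (Lb : Matrix (Fin mb) (Fin mb) (ZMod 2))
    (R S : Matrix (Fin n) (Fin n) (ZMod 2)) (ra rb : ℕ),
    (ra ≤ ma ∧ ra ≤ n ∧ rb ≤ mb ∧ rb ≤ n) ∧
    IsLowerUnitriangular La ∧ IsUpperUnitriangular Lb ∧ IsUpperUnitriangular R ∧
    IsLowerUnitriangular S ∧ S * Rᵀ = 1 ∧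
    A.submatrix σ τ = La * diagBlock ma n 0 0 ra * R ∧
    B.submatrix ρ τ = Lb * diagBlock mb n (mb - rb) (n - rb) rb * S

namespace HasJointDecomposition

variable {ma mb n : ℕ} {A : Matrix (Fin ma) (Fin n) (ZMod 2)}
  {B : Matrix (Fin mb) (Fin n) (ZMod 2)}

theorem zero : HasJointDecomposition (0 : Matrix (Fin ma) (Fin n) (ZMod 2))
    (0 : Matrix (Fin mb) (Fin n) (ZMod 2)) := by
  refine ⟨1, 1, 1, 1, 1, 1, 1, 0, 0, by simp, isLowerUnitriangular_one, isUpperUnitriangular_one,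
    isUpperUnitriangular_one, isLowerUnitriangular_one, by simp, ?_, ?_⟩ <;>
  · ext i j
    simp [diagBlock]

theorem of_submatrix (σ₀ : Equiv.Perm (Fin ma)) (τ₀ : Equiv.Perm (Fin n))
    (h : HasJointDecomposition (A.submatrix σ₀ τ₀) (B.submatrix id τ₀)) :
    HasJointDecomposition A B := by
  obtain ⟨σ, ρ, τ, La, Lb, R, S, ra, rb, hr, hLa, hLb, hR, hS, hSR, hA, hB⟩ := h
  exact ⟨σ.trans σ₀, ρ, τ.trans τ₀, La, Lb, R, S, ra, rb, hr, hLa, hLb, hR, hS, hSR, hA, hB⟩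

theorem of_rev (h : HasJointDecomposition (B.submatrix Fin.revPerm Fin.revPerm)
    (A.submatrix Fin.revPerm Fin.revPerm)) : HasJointDecomposition A B := by
  obtain ⟨σ, ρ, τ, La, Lb, R, S, ra, rb, hr, hLa, hLb, hR, hS, hSR, hA, hB⟩ := h
  refine ⟨(Fin.revPerm.trans ρ).trans Fin.revPerm, (Fin.revPerm.trans σ).trans Fin.revPerm,
    (Fin.revPerm.trans τ).trans Fin.revPerm, _, _, _, _, rb, ra, by omega,
    hLb.rev, hLa.rev, hS.rev, hR.rev, ?_, ?_, ?_⟩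
  · rw [transpose_submatrix, submatrix_mul_equiv, ← transpose_transpose R, ← transpose_mul, hSR]
    simp
  · rw [← diagBlock_rev' hr.2.2.1 hr.2.2.2, submatrix_mul_equiv, submatrix_mul_equiv, ← hB]
    rfl
  · rw [← diagBlock_rev hr.1 hr.2.1, submatrix_mul_equiv, submatrix_mul_equiv, ← hA]
    rfl

theorem border_consCol {u : Fin n → ZMod 2} {v : Fin ma → ZMod 2} {b : Fin mb → ZMod 2}
    (hb : b = -(B *ᵥ u)) (h : HasJointDecomposition A B) :
    HasJointDecomposition (border 1 u v (vecMulVec v u + A)) (consCol b B) := by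
  obtain ⟨σ, ρ, τ, La, Lb, R, S, ra, rb, hr, hLa, hLb, hR, hS, hSR, hA, hB⟩ := h
  refine ⟨succPerm σ, ρ, succPerm τ, border 1 0 (v ∘ σ) La, Lb, border 1 (u ∘ τ) 0 R,
    border 1 0 (-(S *ᵥ (u ∘ τ))) S, ra + 1, rb, by omega, hLa.border, hLb, hR.border, hS.border,
    ?_, ?_, ?_⟩
  · rw [border_transpose, border_mul_border, hSR, ← border_one]
    simp
  · rw [border_submatrix, ← border_diagBlock, border_mul_border, border_mul_border]
    have : (vecMulVec v u + A).submatrix σ τ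
        = vecMulVec (v ∘ σ) (u ∘ τ) + La * diagBlock ma n 0 0 ra * R := by
      rw [← hA]
      rfl
    have hz : vecMulVec (v ∘ σ) (0 : Fin n → ZMod 2) = 0 := by
      ext
      simp [vecMulVec_apply]
    rw [this]
    simp [hz]
  · rw [consCol_submatrix, ← consCol_diagBlock hr.2.2.2, mul_consCol, consCol_mul_border, hB]
    have : b ∘ ρ = -(B.submatrix ρ τ *ᵥ (u ∘ τ)) := by
      rw [submatrix_mulVec_equiv, hb]
      funext i
      simp [Function.comp_assoc]
    rw [this, hB]
    simp [mulVec_neg]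

end HasJointDecomposition

theorem hasJointDecomposition_of_apply_zero_zero {ma mb n : ℕ}
    (ih : ∀ (A : Matrix (Fin ma) (Fin n) (ZMod 2)) (B : Matrix (Fin mb) (Fin n) (ZMod 2)),
      A * Bᵀ = 0 → HasJointDecomposition A B)
    (A : Matrix (Fin (ma + 1)) (Fin (n + 1)) (ZMod 2)) (B : Matrix (Fin mb) (Fin (n + 1)) (ZMod 2))
    (hAB : A * Bᵀ = 0) (hA : A 0 0 = 1) : HasJointDecomposition A B := by
  let u : Fin n → ZMod 2 := fun j => A 0 j.succ
  let v : Fin ma → ZMod 2 := fun i => A i.succ 0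
  let M : Matrix (Fin ma) (Fin n) (ZMod 2) := A.submatrix Fin.succ Fin.succ
  let b : Fin mb → ZMod 2 := fun i => B i 0
  let N : Matrix (Fin mb) (Fin n) (ZMod 2) := B.submatrix id Fin.succ
  have hb : b = -(N *ᵥ u) := by
    funext i
    have h := congrFun₂ hAB 0 i
    simp only [mul_apply, Fin.sum_univ_succ, hA, transpose_apply, Matrix.zero_apply, one_mul] at h
    rw [Pi.neg_apply, ← add_eq_zero_iff_eq_neg, ← h]
    simp [b, N, u, mulVec, dotProduct, mul_comm]
  have hMN : (M - vecMulVec v u) * Nᵀ = 0 := by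
    ext i k
    have h := congrFun₂ hAB i.succ k
    have hk : (N *ᵥ u) k = -b k := by rw [hb, Pi.neg_apply, neg_neg]
    simp only [mul_apply, Fin.sum_univ_succ, transpose_apply, Matrix.zero_apply] at h
    rw [Matrix.sub_mul, vecMulVec_mul, vecMul_transpose, Matrix.sub_apply, vecMulVec_apply, Matrix.zero_apply,
      ← h, hk]
    simp [mul_apply, M, N, v, b, CharTwo.sub_eq_add, add_comm]
  have hA' : A = border 1 u v (vecMulVec v u + (M - vecMulVec v u)) := by
    rw [add_sub_cancel]
    ext i j
    refine Fin.cases ?_ (fun i => ?_) i <;> refine Fin.cases ?_ (fun j => ?_) j <;>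
      simp [hA, u, v, M]
  have hB' : B = consCol b N := by
    ext i j
    refine Fin.cases ?_ (fun j => ?_) j <;> simp [b, N]
  rw [hA', hB']
  exact (ih _ _ hMN).border_consCol hb

theorem hasJointDecomposition_of_ne_zero {ma mb n : ℕ}
    (ih : ∀ (m : ℕ) (A : Matrix (Fin m) (Fin n) (ZMod 2)) (B : Matrix (Fin mb) (Fin n) (ZMod 2)),
      A * Bᵀ = 0 → HasJointDecomposition A B)
    (A : Matrix (Fin ma) (Fin (n + 1)) (ZMod 2)) (B : Matrix (Fin mb) (Fin (n + 1)) (ZMod 2))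
    (hAB : A * Bᵀ = 0) (hA : A ≠ 0) : HasJointDecomposition A B := by
  obtain ⟨i, j, hij⟩ : ∃ i j, A i j ≠ 0 := by
    by_contra! h
    exact hA (Matrix.ext h)
  obtain _ | m := ma
  · exact i.elim0
  refine .of_submatrix (Equiv.swap 0 i) (Equiv.swap 0 j)
    (hasJointDecomposition_of_apply_zero_zero (ih m) _ _ ?_ ?_)
  · rw [transpose_submatrix, submatrix_mul_equiv, hAB]
    rfl
  · simpa using! Fin.eq_one_of_ne_zero (A i j) hij

theorem hasJointDecomposition {n : ℕ} : ∀ {ma mb : ℕ} (A : Matrix (Fin ma) (Fin n) (ZMod 2))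
    (B : Matrix (Fin mb) (Fin n) (ZMod 2)), A * Bᵀ = 0 → HasJointDecomposition A B := by
  induction n with
  | zero =>
    intro ma mb A B _
    rw [Subsingleton.elim A 0, Subsingleton.elim B 0]
    exact .zero
  | succ n ih =>
    intro ma mb A B hAB
    by_cases hA : A = 0
    · by_cases hB : B = 0
      · rw [hA, hB]
        exact .zero
      · refine .of_rev (hasJointDecomposition_of_ne_zero (fun _ => ih) _ _ ?_ fun h => hB ?_)
        · rw [hA]
          simp
        · ext i j
          simpa using congrFun₂ h (Fin.rev i) (Fin.rev j)
    · exact hasJointDecomposition_of_ne_zero (fun _ => ih) _ _ hAB hA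

theorem rank_eq_of_submatrix_eq {m n r a b : ℕ} {A : Matrix (Fin m) (Fin n) (ZMod 2)}
    {σ : Equiv.Perm (Fin m)} {τ : Equiv.Perm (Fin n)} {L : Matrix (Fin m) (Fin m) (ZMod 2)}
    {R : Matrix (Fin n) (Fin n) (ZMod 2)} (hm : a + r ≤ m) (hn : b + r ≤ n)
    (hL : IsUnit L.det) (hR : IsUnit R.det)
    (h : A.submatrix σ τ = L * diagBlock m n a b r * R) : A.rank = r := by
  rw [← rank_submatrix A σ τ, h, rank_mul_eq_left_of_isUnit_det _ _ hR,
    rank_mul_eq_right_of_isUnit_det _ _ hL, rank_diagBlock hm hn]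

theorem IsUpperUnitriangular.det_eq_one {n : ℕ} {M : Matrix (Fin n) (Fin n) (ZMod 2)}
    (h : IsUpperUnitriangular M) : M.det = 1 := by
  rw [det_of_isUpperTriangular fun i j hij => h.1 i j hij]
  simp [h.2]

theorem IsLowerUnitriangular.det_eq_one {n : ℕ} {M : Matrix (Fin n) (Fin n) (ZMod 2)}
    (h : IsLowerUnitriangular M) : M.det = 1 := by
  rw [det_of_isLowerTriangular _ fun i j hij => h.1 i j hij]
  simp [h.2]

theorem perm_mul_mul_perm {m n : ℕ} (σ : Equiv.Perm (Fin m)) (τ : Equiv.Perm (Fin n))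
    (A : Matrix (Fin m) (Fin n) (ZMod 2)) :
    (Matrix.of fun i j => if σ.symm j = i then (1 : ZMod 2) else 0) * A *
      (Matrix.of fun i j => if τ j = i then (1 : ZMod 2) else 0) = A.submatrix σ τ := by
  ext i j
  simp [mul_apply, Equiv.symm_apply_eq]

/-- Joint decomposition of a pair of orthogonal matrices over F₂. -/
theorem joint_decomposition_orthogonal {ma mb n : ℕ}
    (A : Matrix (Fin ma) (Fin n) (ZMod 2)) (B : Matrix (Fin mb) (Fin n) (ZMod 2))
    (hAB : A * Bᵀ = 0) :
    ∃ (Pa : Matrix (Fin ma) (Fin ma) (ZMod 2)) (Pb : Matrix (Fin mb) (Fin mb) (ZMod 2))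
      (Q : Matrix (Fin n) (Fin n) (ZMod 2))
      (La : Matrix (Fin ma) (Fin ma) (ZMod 2)) (Lb : Matrix (Fin mb) (Fin mb) (ZMod 2))
      (R : Matrix (Fin n) (Fin n) (ZMod 2)),
      IsPermMatrix Pa ∧ IsPermMatrix Pb ∧ IsPermMatrix Q ∧
      -- La lower triangular with unit diagonal
      (∀ i j : Fin ma, (i : ℕ) < (j : ℕ) → La i j = 0) ∧ (∀ i : Fin ma, La i i = 1) ∧
      -- Lb upper triangular with unit diagonal
      (∀ i j : Fin mb, (j : ℕ) < (i : ℕ) → Lb i j = 0) ∧ (∀ i : Fin mb, Lb i i = 1) ∧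
      -- R upper triangular with unit diagonal, invertible
      (∀ i j : Fin n, (j : ℕ) < (i : ℕ) → R i j = 0) ∧ (∀ i : Fin n, R i i = 1) ∧
      IsUnit R ∧
      Pa * A * Q =
        La * (Matrix.of fun (i : Fin ma) (j : Fin n) =>
          if (i : ℕ) = (j : ℕ) ∧ (i : ℕ) < A.rank then (1 : ZMod 2) else 0) * R ∧
      Pb * B * Q =
        Lb * (Matrix.of fun (i : Fin mb) (j : Fin n) =>
          if ∃ t : ℕ, t < B.rank ∧ (i : ℕ) = mb - B.rank + t ∧ (j : ℕ) = n - B.rank + t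
          then (1 : ZMod 2) else 0) * (R⁻¹)ᵀ := by
  obtain ⟨σ, ρ, τ, La, Lb, R, S, ra, rb, hr, hLa, hLb, hR, hS, hSR, hA, hB⟩ :=
    hasJointDecomposition A B hAB
  have hra : A.rank = ra := rank_eq_of_submatrix_eq (by omega) (by omega)
    (by simp [hLa.det_eq_one]) (by simp [hR.det_eq_one]) hA
  have hrb : B.rank = rb := rank_eq_of_submatrix_eq (by omega) (by omega)
    (by simp [hLb.det_eq_one]) (by simp [hS.det_eq_one]) hB
  have hSR' : (R⁻¹)ᵀ = S := by
    rw [transpose_nonsing_inv]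
    exact inv_eq_left_inv hSR
  refine ⟨_, _, _, La, Lb, R, ⟨σ.symm, fun _ _ => rfl⟩, ⟨ρ.symm, fun _ _ => rfl⟩,
    ⟨τ, fun _ _ => rfl⟩, hLa.1, hLa.2, hLb.1, hLb.2, hR.1, hR.2,
    (isUnit_iff_isUnit_det R).2 (by simp [hR.det_eq_one]), ?_, ?_⟩
  · refine (perm_mul_mul_perm σ τ A).trans (hA.trans ?_)
    congr 2
    ext i j
    simp only [diagBlock, of_apply, zero_add, hra]
    refine if_congr ⟨?_, fun h => ⟨i, h.2, rfl, h.1.symm⟩⟩ rfl rfl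
    rintro ⟨t, ht, h1, h2⟩
    omega
  · refine (perm_mul_mul_perm ρ τ B).trans (hB.trans ?_)
    rw [hSR', hrb]
    rfl
end

section
/- Let S, T ⊆ {0,1}^m be decreasing sets with S ⊆ T and S ≠ T. Define r(T,S) = max{|t| : t ∈ T \ S} and d(T,S) = min{wt(v) : v ∈ GRM(T) \ GRM(S)}. Then d(T,S) = 2^{m − r(T,S)}. -/
open Matrix

noncomputable section
open scoped Classical

/-- `R_m = [[1,1],[0,1]]^{⊗m}` over F₂. -/
def Rcube (m : ℕ) : Matrix (Fin m → Fin 2) (Fin m → Fin 2) (ZMod 2) :=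
  Matrix.of fun r c => ∏ i, (!![1, 1; 0, 1] : Matrix (Fin 2) (Fin 2) (ZMod 2)) (r i) (c i)

/-- Incomplete permutation matrix `D(U)` with one row per element `u ∈ U`. -/
def Dmat {m : ℕ} (U : Set (Fin m → Fin 2)) : Matrix U (Fin m → Fin 2) (ZMod 2) :=
  Matrix.of fun u v => if v = (u : Fin m → Fin 2) then 1 else 0

/-- `GRM(U) = RowSpan(D(U) · R_m)`. -/
def GRM {m : ℕ} (U : Set (Fin m → Fin 2)) :
    Submodule (ZMod 2) ((Fin m → Fin 2) → ZMod 2) :=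
  Submodule.span (ZMod 2) (Set.range (Dmat U * Rcube m))

/-- Hamming weight of an index tuple `t ∈ {0,1}^m`. -/
def wtv {m : ℕ} (t : Fin m → Fin 2) : ℕ :=
  (Finset.univ.filter fun i : Fin m => t i = 1).card

/-- Hamming weight of a codeword. -/
def wtc {m : ℕ} (v : (Fin m → Fin 2) → ZMod 2) : ℕ :=
  (Finset.univ.filter fun x : Fin m → Fin 2 => v x ≠ 0).card

/-- The sum of the values of a word over the subcube of the points that agree with `y` outside
the support of `t`. -/
def subcubeSum {m : ℕ} (t y : Fin m → Fin 2) :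
    ((Fin m → Fin 2) → ZMod 2) →ₗ[ZMod 2] ZMod 2 where
  toFun v := ∑ x, (∏ i, if t i = 1 ∨ x i = y i then 1 else 0) * v x
  map_add' v w := by simp [mul_add, Finset.sum_add_distrib]
  map_smul' a v := by simp [Finset.mul_sum, mul_left_comm]

lemma subcubeSum_apply {m : ℕ} (t y : Fin m → Fin 2) (v : (Fin m → Fin 2) → ZMod 2) :
    subcubeSum t y v = ∑ x, (∏ i, if t i = 1 ∨ x i = y i then 1 else 0) * v x :=
  rfl

lemma subcubeSum_Rcube {m : ℕ} (s t y : Fin m → Fin 2) :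
    subcubeSum t y ((Rcube m).row s) =
      ∏ i, ∑ a : Fin 2, (if t i = 1 ∨ a = y i then 1 else 0) *
        (!![1, 1; 0, 1] : Matrix (Fin 2) (Fin 2) (ZMod 2)) (s i) a := by
  rw [Finset.prod_univ_sum, Fintype.piFinset_univ, subcubeSum_apply]
  simp only [Rcube, Matrix.row_apply, Matrix.of_apply, Finset.prod_mul_distrib]

lemma subcubeSum_Rcube_self {m : ℕ} (t y : Fin m → Fin 2) :
    subcubeSum t y ((Rcube m).row t) = 1 := by
  rw [subcubeSum_Rcube]
  refine Finset.prod_eq_one fun i _ => ?_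
  generalize t i = a
  generalize y i = b
  revert a b
  decide

lemma subcubeSum_Rcube_of_not_le {m : ℕ} {s t : Fin m → Fin 2} (y : Fin m → Fin 2)
    (h : ¬ t ≤ s) : subcubeSum t y ((Rcube m).row s) = 0 := by
  obtain ⟨i, hi⟩ : ∃ i, ¬ t i ≤ s i := not_forall.1 h
  rw [subcubeSum_Rcube]
  refine Finset.prod_eq_zero (Finset.mem_univ i) ?_
  revert hi
  generalize t i = a
  generalize y i = b
  generalize s i = c
  revert a b c
  decide

lemma exists_ne_zero_of_subcubeSum_ne_zero {m : ℕ} {t y : Fin m → Fin 2}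
    {v : (Fin m → Fin 2) → ZMod 2} (h : subcubeSum t y v ≠ 0) :
    ∃ x, v x ≠ 0 ∧ ∀ i, t i = 1 ∨ x i = y i := by
  obtain ⟨x, -, hx⟩ := Finset.exists_ne_zero_of_sum_ne_zero h
  refine ⟨x, right_ne_zero_of_mul hx, fun i => ?_⟩
  by_contra hi
  exact left_ne_zero_of_mul hx (Finset.prod_eq_zero (Finset.mem_univ i) (if_neg hi))

lemma GRM_eq_span_image {m : ℕ} (U : Set (Fin m → Fin 2)) :
    GRM U = Submodule.span (ZMod 2) ((Rcube m).row '' U) := by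
  have h : (Dmat U * Rcube m).row = fun u : U => (Rcube m).row u := by
    ext u x
    simp [Matrix.mul_apply, Dmat]
  rw [Set.image_eq_range, ← h]
  rfl

lemma card_piFinset_ite_singleton {m : ℕ} (t : Fin m → Fin 2) (a : Fin 2) :
    (Fintype.piFinset fun i => if t i = 1 then {a} else Finset.univ).card =
      2 ^ (m - wtv t) := by
  have h : ∀ i, (if t i = 1 then ({a} : Finset (Fin 2)) else Finset.univ).card =
      if t i = 1 then 1 else 2 := fun i => by split_ifs <;> simp
  have hc := Finset.card_filter_add_card_filter_not (s := Finset.univ) (fun i => t i = 1)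
  rw [Finset.card_univ, Fintype.card_fin] at hc
  rw [Fintype.card_piFinset, Finset.prod_congr rfl fun i _ => h i, Finset.prod_ite]
  simp only [Finset.prod_const, one_pow, one_mul]
  congr 1
  unfold wtv
  omega

lemma wtc_Rcube {m : ℕ} (t : Fin m → Fin 2) : wtc ((Rcube m).row t) = 2 ^ (m - wtv t) := by
  rw [← card_piFinset_ite_singleton t 1, wtc]
  congr 1
  ext x
  simp only [Finset.mem_filter, Finset.mem_univ, true_and, Fintype.mem_piFinset, Rcube,
    Matrix.row_apply, Matrix.of_apply, Finset.prod_ne_zero_iff, forall_const]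
  refine forall_congr' fun i => ?_
  generalize t i = a
  generalize x i = b
  revert a b
  decide

lemma two_pow_le_wtc_of_subcubeSum_ne_zero {m : ℕ} {t : Fin m → Fin 2}
    {v : (Fin m → Fin 2) → ZMod 2} (h : ∀ y, subcubeSum t y v ≠ 0) :
    2 ^ (m - wtv t) ≤ wtc v := by
  rw [← card_piFinset_ite_singleton t 0, wtc]
  refine Finset.card_le_card_of_surjOn (fun x i => if t i = 1 then 0 else x i) fun y hy => ?_
  obtain ⟨x, hx, hxy⟩ := exists_ne_zero_of_subcubeSum_ne_zero (h y)
  refine ⟨x, by simpa using hx, funext fun i => ?_⟩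
  have hyi := Fintype.mem_piFinset.1 hy i
  by_cases hi : t i = 1
  · simp_all
  · simpa [hi] using hxy i

lemma Rcube_notMem_GRM {m : ℕ} {S : Set (Fin m → Fin 2)} (hS : IsLowerSet S)
    {t : Fin m → Fin 2} (ht : t ∉ S) : (Rcube m).row t ∉ GRM S := by
  have hle : GRM S ≤ LinearMap.ker (subcubeSum t 0) := by
    rw [GRM_eq_span_image, Submodule.span_le]
    rintro _ ⟨s, hs, rfl⟩
    exact subcubeSum_Rcube_of_not_le 0 fun hts => ht (hS hts hs)
  intro h
  have h0 : subcubeSum t 0 ((Rcube m).row t) = 0 := hle h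
  rw [subcubeSum_Rcube_self] at h0
  exact one_ne_zero h0

lemma exists_two_pow_le_wtc {m : ℕ} {S T : Set (Fin m → Fin 2)} (hS : IsLowerSet S)
    {v : (Fin m → Fin 2) → ZMod 2} (hvT : v ∈ GRM T) (hvS : v ∉ GRM S) :
    ∃ t ∈ T \ S, 2 ^ (m - wtv t) ≤ wtc v := by
  rw [GRM_eq_span_image, Finsupp.mem_span_image_iff_linearCombination] at hvT hvS
  obtain ⟨l, hl, rfl⟩ := hvT
  obtain ⟨s, hsl, hsS⟩ : ∃ s ∈ l.support, s ∉ S := by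
    by_contra! h
    exact hvS ⟨l, (Finsupp.mem_supported _ l).2 h, rfl⟩
  obtain ⟨t, hst, htmax⟩ := l.support.exists_le_maximal hsl
  refine ⟨t, ⟨(Finsupp.mem_supported _ l).1 hl htmax.prop, fun h => hsS (hS hst h)⟩,
    two_pow_le_wtc_of_subcubeSum_ne_zero fun y => ?_⟩
  rw [Finsupp.linearCombination_apply, map_finsuppSum, Finsupp.sum,
    Finset.sum_eq_single_of_mem t htmax.prop]
  · simpa [subcubeSum_Rcube_self] using htmax.prop
  · intro u hu hut
    rw [map_smul, subcubeSum_Rcube_of_not_le y fun htu => hut (htmax.eq_of_ge hu htu), smul_zero]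


/-- For decreasing `S ⊆ T ⊆ {0,1}^m` with `S ≠ T` and `r = r(T,S) = max{|t| : t ∈ T \ S}`,
the minimum weight `d(T,S) = min{wt v : v ∈ GRM(T) \ GRM(S)}` equals `2^{m−r}`. -/
theorem GRM_nested_distance {m : ℕ} (S T : Set (Fin m → Fin 2))
    (hS : IsLowerSet S) (hT : IsLowerSet T) (hST : S ⊆ T) (hne : S ≠ T)
    (r : ℕ) (hr : IsGreatest {k | ∃ t ∈ T \ S, wtv t = k} r) :
    sInf {k : ℕ∞ | ∃ v, v ∈ GRM T ∧ v ∉ GRM S ∧ (wtc v : ℕ∞) = k} =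
      2 ^ (m - r) := by
  refine IsLeast.csInf_eq ⟨?_, ?_⟩
  · obtain ⟨t, ht, rfl⟩ := hr.1
    refine ⟨(Rcube m).row t, ?_, Rcube_notMem_GRM hS ht.2, ?_⟩
    · rw [GRM_eq_span_image]
      exact Submodule.subset_span ⟨t, ht.1, rfl⟩
    · rw [wtc_Rcube]
      push_cast
      rfl
  · rintro _ ⟨v, hvT, hvS, rfl⟩
    obtain ⟨t, ht, hle⟩ := exists_two_pow_le_wtc hS hvT hvS
    have htr : wtv t ≤ r := hr.2 ⟨t, ht, rfl⟩
    exact_mod_cast (Nat.pow_le_pow_right two_pos (Nat.sub_le_sub_left htr m)).trans hle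
end
end
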